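/- Let λ ∈ (0,1), c_λ > 0, Δx > 0 and Δt > 0, and let h ∈ ℓ^∞(ℤ) ∩ ℓ¹(ℤ). Then there exists a unique v ∈ ℓ^∞(ℤ) ∩ ℓ¹(ℤ) such that v_i − (Δt/Δx) Σ_{j∈ℤ} G^i_j v_j = h_i for every i ∈ ℤ. Moreover inf_{i∈ℤ} h_i ≤ inf_{i∈ℤ} v_i ≤ sup_{i∈ℤ} v_i ≤ sup_{i∈ℤ} h_i and Σ_{i∈ℤ} |v_i| ≤ Σ_{i∈ℤ} |h_i|. -/

import Mathlib

open MeasureTheory Set Filter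
open scoped ENNReal NNReal

/-- The fractional Laplacian `g_λ = -(-∂_x²)^{λ/2}` acting on `φ : ℝ → ℝ`,
defined through the singular integral `c_λ ∫ (φ(x+z) - φ(x)) / |z|^{1+λ} dz`. -/
noncomputable def fracLap (lam clam : ℝ) (φ : ℝ → ℝ) (x : ℝ) : ℝ :=
  clam * ∫ z : ℝ, (φ (x + z) - φ x) / |z| ^ (1 + lam)

/-- The matrix entries `G^i_j = ∫_{I_i} g_λ[1_{I_j}] dx` on the grid of mesh `Δx`. -/
noncomputable def cellG (lam clam dx : ℝ) (i j : ℤ) : ℝ :=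
  ∫ x in Set.Ioo ((i : ℝ) * dx) (((i : ℝ) + 1) * dx),
    fracLap lam clam
      (Set.indicator (Set.Ioo ((j : ℝ) * dx) (((j : ℝ) + 1) * dx)) fun _ => (1 : ℝ)) x

/-- The mass that the kernel `|z|^{-(1+λ)}`, centred at `x`, gives to the set `S`. -/
noncomputable def kernelMass (lam : ℝ) (S : Set ℝ) (x : ℝ) : ℝ :=
  ∫ z : ℝ, S.indicator (fun _ => (1 : ℝ)) (x + z) / |z| ^ (1 + lam)

section Kernel

variable {lam : ℝ}

lemma integral_kernel_tail (hlam : 0 < lam) {δ : ℝ} (hδ : 0 < δ) :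
    ∫ z : ℝ, (Ici δ).indicator (fun t : ℝ => t ^ (-(1 + lam))) |z| = 2 * (δ ^ (-lam) / lam) := by
  rw [integral_comp_abs (f := (Ici δ).indicator fun t : ℝ => t ^ (-(1 + lam))),
    setIntegral_indicator measurableSet_Ici,
    inter_eq_right.2 (Ici_subset_Ioi.2 hδ), integral_Ici_eq_integral_Ioi,
    integral_Ioi_rpow_of_lt (by linarith) hδ]
  have : -(1 + lam) + 1 = -lam := by ring
  rw [this, neg_div_neg_eq]

lemma integrable_kernel_tail (hlam : 0 < lam) {δ : ℝ} (hδ : 0 < δ) :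
    Integrable fun z : ℝ => (Ici δ).indicator (fun t : ℝ => t ^ (-(1 + lam))) |z| := by
  refine .of_integral_ne_zero ?_
  rw [integral_kernel_tail hlam hδ]
  positivity

lemma kernel_nonneg (S : Set ℝ) (x z : ℝ) :
    0 ≤ S.indicator (fun _ => (1 : ℝ)) (x + z) / |z| ^ (1 + lam) := by
  have := indicator_nonneg (s := S) (f := fun _ => (1 : ℝ)) (fun _ _ => zero_le_one) (x + z)
  positivity

lemma kernelMass_nonneg (S : Set ℝ) (x : ℝ) : 0 ≤ kernelMass lam S x :=
  integral_nonneg fun z => kernel_nonneg S x z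

lemma measurable_kernel {S : Set ℝ} (hS : MeasurableSet S) :
    Measurable fun p : ℝ × ℝ => S.indicator (fun _ => (1 : ℝ)) (p.1 + p.2) / |p.2| ^ (1 + lam) :=
  ((measurable_const.indicator hS).comp (measurable_fst.add measurable_snd)).div
    (by fun_prop)

variable {a b x : ℝ} {S : Set ℝ}

lemma kernel_le_tail (hx : x ∈ Ioo a b) (hSd : Disjoint S (Ioo a b)) (z : ℝ) :
    S.indicator (fun _ => (1 : ℝ)) (x + z) / |z| ^ (1 + lam) ≤
      (Ici (min (x - a) (b - x))).indicator (fun t : ℝ => t ^ (-(1 + lam))) |z| := by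
  by_cases hz : x + z ∈ S
  · have hz' : min (x - a) (b - x) ≤ |z| := by
      have := disjoint_left.1 hSd hz
      rw [mem_Ioo, not_and_or, not_lt, not_lt] at this
      rcases this with h | h
      · exact (min_le_left _ _).trans (by linarith [neg_abs_le z])
      · exact (min_le_right _ _).trans (by linarith [le_abs_self z])
    rw [indicator_of_mem hz, indicator_of_mem (mem_Ici.2 hz'), Real.rpow_neg (abs_nonneg z),
      one_div]
  · rw [indicator_of_notMem hz, zero_div]
    exact indicator_nonneg (fun t ht => Real.rpow_nonneg
      ((le_min (sub_pos.2 hx.1).le (sub_pos.2 hx.2).le).trans ht) _) _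

lemma integrable_kernel (hlam : 0 < lam) (hx : x ∈ Ioo a b) (hS : MeasurableSet S)
    (hSd : Disjoint S (Ioo a b)) :
    Integrable fun z : ℝ => S.indicator (fun _ => (1 : ℝ)) (x + z) / |z| ^ (1 + lam) := by
  refine (integrable_kernel_tail hlam (lt_min (sub_pos.2 hx.1) (sub_pos.2 hx.2))).mono'
    ((measurable_kernel hS).comp measurable_prodMk_left).aestronglyMeasurable
    (.of_forall fun z => ?_)
  rw [Real.norm_of_nonneg (kernel_nonneg S x z)]
  exact kernel_le_tail hx hSd z

lemma kernelMass_le (hlam : 0 < lam) (hx : x ∈ Ioo a b) (hS : MeasurableSet S)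
    (hSd : Disjoint S (Ioo a b)) :
    kernelMass lam S x ≤ 2 * (((x - a) ^ (-lam) + (b - x) ^ (-lam)) / lam) := by
  have ha : 0 < x - a := sub_pos.2 hx.1
  have hb : 0 < b - x := sub_pos.2 hx.2
  have hδ : 0 < min (x - a) (b - x) := lt_min ha hb
  calc kernelMass lam S x
      ≤ 2 * (min (x - a) (b - x) ^ (-lam) / lam) := by
        rw [← integral_kernel_tail hlam hδ]
        exact integral_mono (integrable_kernel hlam hx hS hSd) (integrable_kernel_tail hlam hδ)
          (kernel_le_tail hx hSd)
    _ ≤ _ := by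
        gcongr
        rcases min_choice (x - a) (b - x) with h | h <;> rw [h]
        · linarith [Real.rpow_nonneg hb.le (-lam)]
        · linarith [Real.rpow_nonneg ha.le (-lam)]

lemma integrableOn_kernelMass (hlam : lam ∈ Ioo (0 : ℝ) 1) (hS : MeasurableSet S)
    (hSd : Disjoint S (Ioo a b)) : IntegrableOn (kernelMass lam S) (Ioo a b) := by
  rcases le_or_gt b a with hab | hab
  · simp [Ioo_eq_empty_of_le hab]
  have hp : ∀ c, IntervalIntegrable (fun t : ℝ => t ^ (-lam)) volume 0 c := fun c =>
    intervalIntegral.intervalIntegrable_rpow' (by linarith [hlam.2])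
  have h1 : IntervalIntegrable (fun x : ℝ => (x - a) ^ (-lam)) volume a b := by
    simpa using (hp (b - a)).comp_sub_right a
  have h2 : IntervalIntegrable (fun x : ℝ => (b - x) ^ (-lam)) volume a b := by
    simpa using ((hp (b - a)).comp_sub_left b).symm
  have h3 := (((h1.add h2).div_const lam).const_mul 2)
  rw [intervalIntegrable_iff_integrableOn_Ioo_of_le hab.le] at h3
  refine Integrable.mono' h3 ?_ ?_
  · exact (StronglyMeasurable.integral_prod_right'
      (measurable_kernel hS).stronglyMeasurable).aestronglyMeasurable
  · filter_upwards [ae_restrict_mem measurableSet_Ioo] with x hx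
    rw [Real.norm_of_nonneg (kernelMass_nonneg S x)]
    exact kernelMass_le hlam.1 hx hS hSd

lemma fracLap_indicator_of_notMem (clam : ℝ) (hx : x ∉ S) :
    fracLap lam clam (S.indicator fun _ => (1 : ℝ)) x = clam * kernelMass lam S x := by
  simp [fracLap, kernelMass, indicator_of_notMem hx]

lemma fracLap_indicator_of_mem (clam : ℝ) (hx : x ∈ S) :
    fracLap lam clam (S.indicator fun _ => (1 : ℝ)) x = -(clam * kernelMass lam Sᶜ x) := by
  have : ∀ z, (S.indicator (fun _ => (1 : ℝ)) (x + z) - S.indicator (fun _ => (1 : ℝ)) x) /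
      |z| ^ (1 + lam) = -(Sᶜ.indicator (fun _ => (1 : ℝ)) (x + z) / |z| ^ (1 + lam)) := by
    intro z
    rw [indicator_of_mem hx, ← neg_div]
    by_cases hz : x + z ∈ S <;> simp [hz]
  simp only [fracLap, kernelMass, this, integral_neg, mul_neg]

/-- The kernel mass is finitely subadditive, hence bounded by the mass of any set containing the
pairwise disjoint pieces. -/
lemma sum_kernelMass_le {ι : Type*} (hlam : 0 < lam) (hx : x ∈ Ioo a b) (F : Finset ι)
    (T : ι → Set ℝ) (hT : ∀ j ∈ F, MeasurableSet (T j)) (hTS : ∀ j ∈ F, T j ⊆ S)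
    (hTd : (F : Set ι).PairwiseDisjoint T) (hS : MeasurableSet S) (hSd : Disjoint S (Ioo a b)) :
    ∑ j ∈ F, kernelMass lam (T j) x ≤ kernelMass lam S x := by
  have hint : ∀ j ∈ F, Integrable fun z : ℝ =>
      (T j).indicator (fun _ => (1 : ℝ)) (x + z) / |z| ^ (1 + lam) := fun j hj =>
    integrable_kernel hlam hx (hT j hj) (hSd.mono_left (hTS j hj))
  simp only [kernelMass]
  rw [← integral_finsetSum F hint]
  refine integral_mono (integrable_finsetSum F hint) (integrable_kernel hlam hx hS hSd) fun z => ?_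
  simp only [← Finset.sum_div]
  gcongr
  rw [← Finset.indicator_biUnion_apply F T hTd]
  exact indicator_le_indicator_of_subset (iUnion₂_subset hTS) (fun _ => zero_le_one) _

end Kernel

section Cells

variable {lam clam dx : ℝ}

lemma disjoint_cells (hdx : 0 < dx) {i j : ℤ} (hij : i ≠ j) :
    Disjoint (Ioo ((i : ℝ) * dx) (((i : ℝ) + 1) * dx))
      (Ioo ((j : ℝ) * dx) (((j : ℝ) + 1) * dx)) := by
  rw [disjoint_left]
  rintro y ⟨h1, h2⟩ ⟨h3, h4⟩
  have h5 := lt_of_mul_lt_mul_right (h1.trans h4) hdx.le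
  have h6 := lt_of_mul_lt_mul_right (h3.trans h2) hdx.le
  norm_cast at h5 h6
  omega

lemma fracLap_comp_add_right (φ : ℝ → ℝ) (c x : ℝ) :
    fracLap lam clam (fun y => φ (y + c)) x = fracLap lam clam φ (x + c) := by
  simp only [fracLap, add_right_comm]

lemma cellG_eq_cellG_zero (i j : ℤ) : cellG lam clam dx i j = cellG lam clam dx 0 (j - i) := by
  have hφ : (Ioo (((j - i : ℤ) : ℝ) * dx) ((((j - i : ℤ) : ℝ) + 1) * dx)).indicator
      (fun _ => (1 : ℝ)) = fun y => (Ioo ((j : ℝ) * dx) (((j : ℝ) + 1) * dx)).indicator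
        (fun _ => (1 : ℝ)) (y + i * dx) := by
    funext y
    simp only [indicator_apply, mem_Ioo]
    push_cast
    congr 1
    apply propext
    constructor <;> rintro ⟨h1, h2⟩ <;> constructor <;> linarith
  have hI : Ioo (((0 : ℤ) : ℝ) * dx) ((((0 : ℤ) : ℝ) + 1) * dx) =
      (fun x : ℝ => x + i * dx) ⁻¹' Ioo ((i : ℝ) * dx) (((i : ℝ) + 1) * dx) := by
    rw [preimage_add_const_Ioo]
    push_cast
    congr 1 <;> ring
  unfold cellG
  simp only [hφ, fracLap_comp_add_right, hI]
  exact ((measurePreserving_add_right volume ((i : ℝ) * dx)).setIntegral_preimage_emb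
    (measurableEmbedding_addRight _) _ _).symm

lemma cellG_of_ne (hdx : 0 < dx) {i j : ℤ} (hij : i ≠ j) :
    cellG lam clam dx i j = ∫ x in Ioo ((i : ℝ) * dx) (((i : ℝ) + 1) * dx),
      clam * kernelMass lam (Ioo ((j : ℝ) * dx) (((j : ℝ) + 1) * dx)) x :=
  setIntegral_congr_fun measurableSet_Ioo fun _ hx =>
    fracLap_indicator_of_notMem clam (disjoint_left.1 (disjoint_cells hdx hij) hx)

lemma cellG_self (i : ℤ) :
    cellG lam clam dx i i = -∫ x in Ioo ((i : ℝ) * dx) (((i : ℝ) + 1) * dx),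
      clam * kernelMass lam (Ioo ((i : ℝ) * dx) (((i : ℝ) + 1) * dx))ᶜ x := by
  rw [← integral_neg]
  exact setIntegral_congr_fun measurableSet_Ioo fun _ hx => fracLap_indicator_of_mem clam hx

lemma cellG_nonneg (hclam : 0 < clam) (hdx : 0 < dx) {i j : ℤ} (hij : i ≠ j) :
    0 ≤ cellG lam clam dx i j := by
  rw [cellG_of_ne hdx hij]
  exact integral_nonneg fun x => mul_nonneg hclam.le (kernelMass_nonneg _ x)

lemma sum_cellG_le (hlam : lam ∈ Ioo (0 : ℝ) 1) (hclam : 0 < clam) (hdx : 0 < dx) (i : ℤ)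
    (F : Finset ℤ) (hF : i ∉ F) :
    ∑ j ∈ F, cellG lam clam dx i j ≤ -cellG lam clam dx i i := by
  have hne : ∀ j ∈ F, i ≠ j := fun j hj h => hF (h ▸ hj)
  have hd : ∀ j ∈ F, Disjoint (Ioo ((j : ℝ) * dx) (((j : ℝ) + 1) * dx))
      (Ioo ((i : ℝ) * dx) (((i : ℝ) + 1) * dx)) := fun j hj => disjoint_cells hdx (hne j hj).symm
  rw [cellG_self, neg_neg, Finset.sum_congr rfl fun j hj => cellG_of_ne hdx (hne j hj),
    ← integral_finsetSum F fun j hj =>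
      (integrableOn_kernelMass hlam measurableSet_Ioo (hd j hj)).const_mul clam]
  refine setIntegral_mono_on
    (integrable_finsetSum F fun j hj =>
      (integrableOn_kernelMass hlam measurableSet_Ioo (hd j hj)).const_mul clam)
    ((integrableOn_kernelMass hlam measurableSet_Ioo.compl disjoint_compl_left).const_mul clam)
    measurableSet_Ioo fun x hx => ?_
  rw [← Finset.mul_sum]
  gcongr
  exact sum_kernelMass_le hlam.1 hx F _ (fun _ _ => measurableSet_Ioo)
    (fun j hj => (hd j hj).subset_compl_right) (fun j _ k _ hjk => disjoint_cells hdx hjk)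
    measurableSet_Ioo.compl disjoint_compl_left

end Cells

section Convolution

variable {b v : ℤ → ℝ}

lemma summable_prod_shift (hb : Summable b) (hb0 : ∀ k, 0 ≤ b k) (hv : Summable fun i => |v i|) :
    Summable fun p : ℤ × ℤ => b p.2 * |v (p.1 + p.2)| := by
  have h := hv.mul_of_nonneg hb (fun i => abs_nonneg (v i)) hb0
  let e : ℤ × ℤ ≃ ℤ × ℤ :=
    { toFun := fun p => (p.1 + p.2, p.2)
      invFun := fun p => (p.1 - p.2, p.2)
      left_inv := fun p => by simp
      right_inv := fun p => by simp }
  simpa [Function.comp_def, e, mul_comm] using e.summable_iff.2 h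

lemma tsum_tsum_shift (hb : Summable b) (hb0 : ∀ k, 0 ≤ b k) (hv : Summable fun i => |v i|) :
    ∑' i, ∑' k, b k * |v (i + k)| = (∑' k, b k) * ∑' i, |v i| := by
  have h := summable_prod_shift hb hb0 hv
  rw [Summable.tsum_comm (f := fun k i => b k * |v (i + k)|) h.prod_symm, ← tsum_mul_right]
  refine tsum_congr fun k => ?_
  rw [tsum_mul_left]
  congr 1
  exact (Equiv.addRight k).tsum_eq fun i => |v i|

lemma summable_shift (hb : Summable b) (hb0 : ∀ k, 0 ≤ b k) (hv : Summable fun i => |v i|)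
    (i : ℤ) : Summable fun k => b k * v (i + k) := by
  refine .of_abs ?_
  simpa [abs_mul, abs_of_nonneg (hb0 _)] using (summable_prod_shift hb hb0 hv).prod_factor i

lemma abs_tsum_shift_le (hb : Summable b) (hb0 : ∀ k, 0 ≤ b k) (hv : Summable fun i => |v i|)
    (i : ℤ) : |∑' k, b k * v (i + k)| ≤ ∑' k, b k * |v (i + k)| := by
  have h := norm_tsum_le_tsum_norm (f := fun k => b k * v (i + k))
    (summable_shift hb hb0 hv i).norm
  simpa only [norm_mul, Real.norm_eq_abs, abs_of_nonneg (hb0 _)] using h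

lemma summable_abs_tsum_shift (hb : Summable b) (hb0 : ∀ k, 0 ≤ b k)
    (hv : Summable fun i => |v i|) : Summable fun i => |∑' k, b k * v (i + k)| :=
  .of_nonneg_of_le (fun _ => abs_nonneg _) (abs_tsum_shift_le hb hb0 hv)
    (summable_prod_shift hb hb0 hv).prod

lemma tsum_abs_tsum_shift_le (hb : Summable b) (hb0 : ∀ k, 0 ≤ b k)
    (hv : Summable fun i => |v i|) :
    ∑' i, |∑' k, b k * v (i + k)| ≤ (∑' k, b k) * ∑' i, |v i| := by
  rw [← tsum_tsum_shift hb hb0 hv]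
  exact (summable_abs_tsum_shift hb hb0 hv).tsum_le_tsum (abs_tsum_shift_le hb hb0 hv)
    (summable_prod_shift hb hb0 hv).prod

variable {h : ℤ → ℝ}

/-- `v = h + b ⋆ v` is solvable in `ℓ¹` when `b` has mass less than one. -/
lemma exists_eq_add_tsum_shift (hb : Summable b) (hb0 : ∀ k, 0 ≤ b k) (hb1 : ∑' k, b k < 1)
    (hh : Summable fun i => |h i|) :
    ∃ v : ℤ → ℝ, (Summable fun i => |v i|) ∧ ∀ i, v i = h i + ∑' k, b k * v (i + k) := by
  have hmem : ∀ {u : ℤ → ℝ}, Memℓp u 1 ↔ Summable fun i => |u i| := fun {u} => by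
    rw [memℓp_gen_iff (by simp)]
    simp
  have hu (u : lp (fun _ : ℤ => ℝ) 1) : Summable fun i => |u i| := hmem.1 (lp.memℓp u)
  have hnorm (u : lp (fun _ : ℤ => ℝ) 1) : ‖u‖ = ∑' i, |u i| := by
    simp [lp.norm_eq_tsum_rpow (p := 1) (by simp) u]
  let Φ : lp (fun _ : ℤ => ℝ) 1 → lp (fun _ : ℤ => ℝ) 1 := fun u =>
    ⟨fun i => h i + ∑' k, b k * u (i + k), (hmem.2 hh).add
      (hmem.2 (summable_abs_tsum_shift hb hb0 (hu u)))⟩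
  have hΦ : ContractingWith ⟨∑' k, b k, tsum_nonneg hb0⟩ Φ := by
    refine ⟨by exact_mod_cast hb1, LipschitzWith.of_dist_le_mul fun u w => ?_⟩
    rw [dist_eq_norm, dist_eq_norm, hnorm, hnorm]
    refine le_trans (le_of_eq (tsum_congr fun i => ?_)) (tsum_abs_tsum_shift_le hb hb0
      (hu (u - w)))
    have hs := (summable_shift hb hb0 (hu u) i).tsum_sub (summable_shift hb hb0 (hu w) i)
    congr 1
    simp only [lp.coeFn_sub, Pi.sub_apply, mul_sub, hs, Φ]
    ring
  obtain ⟨u, hfix⟩ : ∃ u, Φ u = u := ⟨_, hΦ.fixedPoint_isFixedPt⟩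
  exact ⟨u, hu u, fun i => congr_arg (fun w : lp (fun _ : ℤ => ℝ) 1 => w i) hfix.symm⟩

end Convolution

section Equation

variable {a h v : ℤ → ℝ} {μ : ℝ}

/-- Data of a translation-invariant generator on `ℤ`: nonnegative off-diagonal entries with
total mass at most `-a 0`. -/
structure IsGeneratorRow (a : ℤ → ℝ) : Prop where
  nonneg : ∀ k, k ≠ 0 → 0 ≤ a k
  sum_le : ∀ F : Finset ℤ, 0 ∉ F → ∑ k ∈ F, a k ≤ -a 0

namespace IsGeneratorRow

lemma update_nonneg (ha : IsGeneratorRow a) (k : ℤ) : 0 ≤ Function.update a 0 0 k := by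
  rcases eq_or_ne k 0 with rfl | hk
  · simp
  · simpa [hk] using ha.nonneg k hk

lemma sum_update_le (ha : IsGeneratorRow a) (F : Finset ℤ) :
    ∑ k ∈ F, Function.update a 0 0 k ≤ -a 0 := by
  rw [← Finset.sum_erase F (a := 0) (by simp)]
  refine le_of_eq_of_le (Finset.sum_congr rfl fun k hk => ?_)
    (ha.sum_le (F.erase 0) (by simp))
  simp [Finset.ne_of_mem_erase hk]

lemma summable_update (ha : IsGeneratorRow a) : Summable (Function.update a 0 0) :=
  summable_of_sum_le ha.update_nonneg ha.sum_update_le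

lemma tsum_update_le (ha : IsGeneratorRow a) : ∑' k, Function.update a 0 0 k ≤ -a 0 :=
  Real.tsum_le_of_sum_le ha.update_nonneg ha.sum_update_le

lemma tsum_shift (ha : IsGeneratorRow a) (hv : Summable fun i => |v i|) (i : ℤ) :
    ∑' j, a (j - i) * v j = a 0 * v i + ∑' k, Function.update a 0 0 k * v (i + k) := by
  rw [← (Equiv.addLeft i).tsum_eq fun j => a (j - i) * v j]
  have h1 : HasSum (fun k => (Pi.single 0 (a 0 * v i) : ℤ → ℝ) k) (a 0 * v i) :=
    hasSum_pi_single 0 _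
  have h2 := (summable_shift ha.summable_update ha.update_nonneg hv i).hasSum
  rw [← (h1.add h2).tsum_eq]
  refine tsum_congr fun k => ?_
  rcases eq_or_ne k 0 with rfl | hk
  · simp
  · simp [hk]

/-- The implicit equation, with the diagonal term isolated. -/
lemma equation_iff (ha : IsGeneratorRow a) (hv : Summable fun i => |v i|) (i : ℤ) :
    v i - μ * ∑' j, a (j - i) * v j = h i ↔
      (1 + μ * -a 0) * v i = h i + μ * ∑' k, Function.update a 0 0 k * v (i + k) := by
  rw [ha.tsum_shift hv]
  constructor <;> intro h <;> linarith

lemma exists_solution (ha : IsGeneratorRow a) (hμ : 0 < μ) (hh : Summable fun i => |h i|) :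
    ∃ v : ℤ → ℝ, (Summable fun i => |v i|) ∧
      ∀ i, v i - μ * ∑' j, a (j - i) * v j = h i := by
  have h0 : 0 ≤ -a 0 := by simpa using ha.sum_le ∅
  have hd : 0 < 1 + μ * -a 0 := by positivity
  obtain ⟨v, hv, hveq⟩ := exists_eq_add_tsum_shift
    (b := fun k => μ / (1 + μ * -a 0) * Function.update a 0 0 k)
    (h := fun i => (1 + μ * -a 0)⁻¹ * h i) (ha.summable_update.mul_left _)
    (fun k => mul_nonneg (by positivity) (ha.update_nonneg k))
    (by
      rw [tsum_mul_left, div_mul_eq_mul_div, div_lt_one hd]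
      linarith [mul_le_mul_of_nonneg_left ha.tsum_update_le hμ.le])
    (by simpa only [abs_mul] using hh.mul_left _)
  refine ⟨v, hv, fun i => (ha.equation_iff hv i).2 ?_⟩
  have := hveq i
  simp only [mul_assoc, tsum_mul_left] at this
  rw [this, mul_add, mul_inv_cancel_left₀ hd.ne', ← mul_assoc, mul_div_cancel₀ _ hd.ne']

lemma tsum_abs_le (ha : IsGeneratorRow a) (hμ : 0 < μ) (hh : Summable fun i => |h i|)
    (hv : Summable fun i => |v i|) (heq : ∀ i, v i - μ * ∑' j, a (j - i) * v j = h i) :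
    ∑' i, |v i| ≤ ∑' i, |h i| := by
  have h0 : 0 ≤ -a 0 := by simpa using ha.sum_le ∅
  have hd : 0 < 1 + μ * -a 0 := by positivity
  have hs := summable_abs_tsum_shift ha.summable_update ha.update_nonneg hv
  have key : (1 + μ * -a 0) * ∑' i, |v i| ≤
      ∑' i, |h i| + μ * ∑' i, |∑' k, Function.update a 0 0 k * v (i + k)| := by
    rw [← tsum_mul_left, ← tsum_mul_left, ← hh.tsum_add (hs.mul_left μ)]
    refine (hv.mul_left _).tsum_le_tsum (fun i => ?_) (hh.add (hs.mul_left μ))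
    rw [← abs_of_pos hd, ← abs_mul, (ha.equation_iff hv i).1 (heq i)]
    refine (abs_add_le _ _).trans ?_
    rw [abs_mul, abs_of_pos hμ]
  have h1 := tsum_abs_tsum_shift_le ha.summable_update ha.update_nonneg hv
  have h2 := mul_le_mul_of_nonneg_right ha.tsum_update_le
    (show 0 ≤ ∑' i, |v i| from tsum_nonneg fun i => abs_nonneg (v i))
  linarith [mul_le_mul_of_nonneg_left (h1.trans h2) hμ.le]

lemma solution_unique (ha : IsGeneratorRow a) (hμ : 0 < μ) {w : ℤ → ℝ}
    (hv : Summable fun i => |v i|) (heq : ∀ i, v i - μ * ∑' j, a (j - i) * v j = h i)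
    (hw : Summable fun i => |w i|) (hweq : ∀ i, w i - μ * ∑' j, a (j - i) * w j = h i) :
    w = v := by
  have hwv : Summable fun i => |w i - v i| := (hw.of_abs.sub hv.of_abs).abs
  have hle := ha.tsum_abs_le hμ (h := fun _ => 0) (by simp) hwv fun i => by
    have h1 := (ha.equation_iff hv i).1 (heq i)
    have h2 := (ha.equation_iff hw i).1 (hweq i)
    rw [ha.equation_iff (v := fun i => w i - v i) (h := fun _ => 0) hwv i]
    simp only [mul_sub]
    rw [(summable_shift ha.summable_update ha.update_nonneg hw i).tsum_sub
      (summable_shift ha.summable_update ha.update_nonneg hv i)]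
    linarith
  funext i
  have := (hwv.le_tsum i fun j _ => abs_nonneg _).trans hle
  simpa [sub_eq_zero] using this

lemma le_of_forall_le (ha : IsGeneratorRow a) (hμ : 0 < μ) (hv : Summable fun i => |v i|)
    (heq : ∀ i, v i - μ * ∑' j, a (j - i) * v j = h i) {H : ℝ} (hH : ∀ i, h i ≤ H) (i : ℤ) :
    v i ≤ H := by
  have h0 : 0 ≤ -a 0 := by simpa using ha.sum_le ∅
  have hd : 0 < 1 + μ * -a 0 := by positivity
  have hbdd : BddAbove (range v) :=
    ⟨∑' i, |v i|, forall_mem_range.2 fun i => (le_abs_self _).trans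
      (hv.le_tsum i fun j _ => abs_nonneg _)⟩
  have hV : 0 ≤ ⨆ j, v j :=
    le_of_tendsto hv.of_abs.tendsto_cofinite_zero (.of_forall fun j => le_ciSup hbdd j)
  have hle : ∀ j, v j ≤ (H + μ * (-a 0 * ⨆ j, v j)) / (1 + μ * -a 0) := fun j => by
    rw [le_div_iff₀' hd, (ha.equation_iff hv j).1 (heq j)]
    gcongr
    · exact hH j
    · refine le_trans ?_ (mul_le_mul_of_nonneg_right ha.tsum_update_le hV)
      rw [← tsum_mul_right]
      exact (summable_shift ha.summable_update ha.update_nonneg hv j).tsum_le_tsum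
        (fun k => mul_le_mul_of_nonneg_left (le_ciSup hbdd _) (ha.update_nonneg k))
        (ha.summable_update.mul_right _)
  have hsup := ciSup_le hle
  rw [le_div_iff₀' hd] at hsup
  exact (le_ciSup hbdd i).trans (by linarith)

lemma ge_of_forall_ge (ha : IsGeneratorRow a) (hμ : 0 < μ) (hv : Summable fun i => |v i|)
    (heq : ∀ i, v i - μ * ∑' j, a (j - i) * v j = h i) {H : ℝ} (hH : ∀ i, H ≤ h i) (i : ℤ) :
    H ≤ v i := by
  refine neg_le_neg_iff.1 (ha.le_of_forall_le hμ (v := fun i => -v i) (h := fun i => -h i)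
    (by simpa using hv) (fun j => ?_) (fun j => neg_le_neg (hH j)) i)
  simp only [mul_neg, tsum_neg, ← heq j]
  ring

end IsGeneratorRow

end Equation

lemma isGeneratorRow_cellG {lam clam dx : ℝ} (hlam : lam ∈ Ioo (0 : ℝ) 1) (hclam : 0 < clam)
    (hdx : 0 < dx) : IsGeneratorRow (cellG lam clam dx 0) where
  nonneg _ hk := cellG_nonneg hclam hdx hk.symm
  sum_le := sum_cellG_le hlam hclam hdx 0

/-- Appendix C: the implicit problem `v_i − (Δt/Δx) Σ_j G^i_j v_j = h_i` has a unique
solution `v ∈ ℓ^∞(ℤ) ∩ ℓ¹(ℤ)` for `h ∈ ℓ^∞(ℤ) ∩ ℓ¹(ℤ)`; moreover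
`inf h ≤ inf v ≤ sup v ≤ sup h` and `Σ|v_i| ≤ Σ|h_i|`. -/
theorem stmt_10 (lam clam dx dt : ℝ) (hlam : lam ∈ Set.Ioo (0 : ℝ) 1) (hclam : 0 < clam)
    (hdx : 0 < dx) (hdt : 0 < dt)
    (h : ℤ → ℝ) (hsum : Summable fun i => |h i|) (hbdd : ∃ M : ℝ, ∀ i, |h i| ≤ M) :
    ∃ v : ℤ → ℝ,
      (Summable (fun i => |v i|) ∧ (∃ M : ℝ, ∀ i, |v i| ≤ M) ∧
        ∀ i : ℤ, v i - (dt / dx) * ∑' j : ℤ, cellG lam clam dx i j * v j = h i) ∧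
      (∀ w : ℤ → ℝ, Summable (fun i => |w i|) → (∃ M : ℝ, ∀ i, |w i| ≤ M) →
        (∀ i : ℤ, w i - (dt / dx) * ∑' j : ℤ, cellG lam clam dx i j * w j = h i) →
        w = v) ∧
      (⨅ i : ℤ, h i) ≤ (⨅ i : ℤ, v i) ∧
      (⨅ i : ℤ, v i) ≤ (⨆ i : ℤ, v i) ∧
      (⨆ i : ℤ, v i) ≤ (⨆ i : ℤ, h i) ∧
      ∑' i : ℤ, |v i| ≤ ∑' i : ℤ, |h i| := by
  have ha := isGeneratorRow_cellG hlam hclam hdx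
  have hμ : 0 < dt / dx := div_pos hdt hdx
  obtain ⟨M, hM⟩ := hbdd
  have hbelow : BddBelow (range h) := ⟨-M, forall_mem_range.2 fun i => (abs_le.1 (hM i)).1⟩
  have habove : BddAbove (range h) := ⟨M, forall_mem_range.2 fun i => (abs_le.1 (hM i)).2⟩
  have hG : ∀ i j, cellG lam clam dx i j = cellG lam clam dx 0 (j - i) := cellG_eq_cellG_zero
  generalize cellG lam clam dx 0 = a at ha hG
  simp only [hG]
  obtain ⟨v, hv, heq⟩ := ha.exists_solution hμ hsum
  have hlow := ha.ge_of_forall_ge hμ hv heq fun i => ciInf_le hbelow i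
  have hupp := ha.le_of_forall_le hμ hv heq fun i => le_ciSup habove i
  exact ⟨v, ⟨hv, ⟨_, fun i => hv.le_tsum i fun j _ => abs_nonneg (v j)⟩, heq⟩,
    fun w hw _ hweq => ha.solution_unique hμ hv heq hw hweq,
    le_ciInf hlow,
    (ciInf_le ⟨_, forall_mem_range.2 hlow⟩ 0).trans (le_ciSup ⟨_, forall_mem_range.2 hupp⟩ 0),
    ciSup_le hupp, ha.tsum_abs_le hμ hsum hv heq⟩
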